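/- (Claim (2) in the proof of Theorem 3.2) Let A be a three-valued Łukasiewicz algebra, Ob the set of prime filters of A, R the comparability relation on Ob (P R Q iff P ⊆ Q or Q ⊆ P), M X = {P ∈ Ob | ∃ Q ∈ X, P R Q} for X ⊆ Ob, and s(x) = {P ∈ Ob | x ∈ P} the Stone map. Then for every x ∈ A, M s(x) = s(∇x). -/

import Mathlib

/-- A prime filter of a bounded distributive lattice. -/
def IsPrimeFilter {A : Type*} [DistribLattice A] [BoundedOrder A] (P : Set A) : Prop :=
  P.Nonempty ∧ P ≠ Set.univ ∧ (∀ x ∈ P, ∀ y : A, x ≤ y → y ∈ P) ∧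
    (∀ x ∈ P, ∀ y ∈ P, x ⊓ y ∈ P) ∧ (∀ x y : A, x ⊔ y ∈ P → x ∈ P ∨ y ∈ P)

namespace IsPrimeFilter

variable {A : Type*} [DistribLattice A] [BoundedOrder A] {P Q : Set A}

theorem top_mem (hP : IsPrimeFilter P) : ⊤ ∈ P :=
  let ⟨y, hy⟩ := hP.1
  hP.2.2.1 y hy ⊤ le_top

theorem bot_notMem (hP : IsPrimeFilter P) : ⊥ ∉ P := fun h =>
  hP.2.1 (Set.eq_univ_of_forall fun y => hP.2.2.1 ⊥ h y bot_le)

theorem mem_of_le (hP : IsPrimeFilter P) {x y : A} (hx : x ∈ P) (hxy : x ≤ y) : y ∈ P :=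
  hP.2.2.1 x hx y hxy

theorem inf_mem (hP : IsPrimeFilter P) {x y : A} (hx : x ∈ P) (hy : y ∈ P) : x ⊓ y ∈ P :=
  hP.2.2.2.1 x hx y hy

theorem mem_or_mem (hP : IsPrimeFilter P) {x y : A} (h : x ⊔ y ∈ P) : x ∈ P ∨ y ∈ P :=
  hP.2.2.2.2 x y h

/-- A prime filter contained in another one contains the same complemented elements. -/
theorem mem_of_subset_of_isCompl (hP : IsPrimeFilter P) (hQ : IsPrimeFilter Q) (hPQ : P ⊆ Q)
    {b c : A} (hbc : IsCompl b c) (hb : b ∈ Q) : b ∈ P := by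
  refine (hP.mem_or_mem (hbc.sup_eq_top ▸ hP.top_mem)).resolve_right fun hc => ?_
  exact hQ.bot_notMem (hbc.inf_eq_bot ▸ hQ.inf_mem hb (hPQ hc))

end IsPrimeFilter

section DeMorgan

variable {A : Type*} [DistribLattice A] {neg : A → A}

theorem deMorgan_neg_inf (hinv : ∀ x, neg (neg x) = x)
    (hdm : ∀ x y, neg (x ⊔ y) = neg x ⊓ neg y) (x y : A) :
    neg (x ⊓ y) = neg x ⊔ neg y := by
  rw [← hinv (neg x ⊔ neg y), hdm, hinv, hinv]

theorem deMorgan_neg_antitone (hdm : ∀ x y, neg (x ⊔ y) = neg x ⊓ neg y) : Antitone neg := by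
  intro x y h
  rw [← sup_eq_right.mpr h, hdm]
  exact inf_le_left

variable [BoundedOrder A]

theorem deMorgan_neg_top (hinv : ∀ x, neg (neg x) = x)
    (hdm : ∀ x y, neg (x ⊔ y) = neg x ⊓ neg y) : neg ⊤ = ⊥ :=
  le_bot_iff.mp (hinv ⊥ ▸ deMorgan_neg_antitone hdm le_top)

theorem deMorgan_neg_bot (hinv : ∀ x, neg (neg x) = x)
    (hdm : ∀ x y, neg (x ⊔ y) = neg x ⊓ neg y) : neg ⊥ = ⊤ := by
  rw [← deMorgan_neg_top hinv hdm, hinv]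

/-- The Białynicki-Birula–Rasiowa transform of a prime filter is a prime filter. -/
theorem IsPrimeFilter.setOf_neg_notMem (hinv : ∀ x, neg (neg x) = x)
    (hdm : ∀ x y, neg (x ⊔ y) = neg x ⊓ neg y) {P : Set A} (hP : IsPrimeFilter P) :
    IsPrimeFilter {a | neg a ∉ P} := by
  refine ⟨⟨⊤, ?_⟩, fun h => ?_, fun a ha b hab hb => ?_, fun a ha b hb h => ?_, fun a b h => ?_⟩
  · simpa [deMorgan_neg_top hinv hdm] using hP.bot_notMem
  · have hbot : (⊥ : A) ∈ {a | neg a ∉ P} := h ▸ Set.mem_univ _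
    exact hbot (deMorgan_neg_bot hinv hdm ▸ hP.top_mem)
  · exact ha (hP.mem_of_le hb (deMorgan_neg_antitone hdm hab))
  · rw [deMorgan_neg_inf hinv hdm] at h
    exact (hP.mem_or_mem h).elim ha hb
  · by_contra! hab
    simp only [Set.mem_ofPred_eq, not_not] at hab
    exact h (hdm a b ▸ hP.inf_mem hab.1 hab.2)

end DeMorgan

section Lukasiewicz

variable {A : Type*} [DistribLattice A] [BoundedOrder A] {neg nabla : A → A}

theorem lukasiewicz_le_nabla (hax1 : ∀ x, neg x ⊔ nabla x = ⊤)
    (hax2 : ∀ x, x ⊓ neg x = neg x ⊓ nabla x) (x : A) : x ≤ nabla x := by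
  calc x = x ⊓ (neg x ⊔ nabla x) := by rw [hax1, inf_top_eq]
    _ = neg x ⊓ nabla x ⊔ x ⊓ nabla x := by rw [inf_sup_left, hax2]
    _ ≤ nabla x := sup_le inf_le_right inf_le_right

theorem lukasiewicz_isCompl_nabla (hinv : ∀ x, neg (neg x) = x)
    (hdm : ∀ x y, neg (x ⊔ y) = neg x ⊓ neg y)
    (hax1 : ∀ x, neg x ⊔ nabla x = ⊤)
    (hax2 : ∀ x, x ⊓ neg x = neg x ⊓ nabla x)
    (hax3 : ∀ x y, nabla (x ⊓ y) = nabla x ⊓ nabla y) (x : A) :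
    IsCompl (nabla x) (neg (nabla x)) := by
  have hbot : nabla (⊥ : A) = ⊥ := by
    simpa [deMorgan_neg_bot hinv hdm] using (hax2 ⊥).symm
  have hdisj : x ⊓ neg (nabla x) = ⊥ := by
    rw [← deMorgan_neg_top hinv hdm, ← hax1 x, hdm, hinv]
  have hinf : nabla x ⊓ neg (nabla x) = ⊥ := by
    rw [← le_bot_iff, ← hbot, ← hdisj, hax3]
    exact inf_le_inf_left _ (lukasiewicz_le_nabla hax1 hax2 _)
  refine IsCompl.of_eq hinf ?_
  rw [← deMorgan_neg_bot hinv hdm, ← hinf, deMorgan_neg_inf hinv hdm, hinv, sup_comm]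

/-- Three-valued Łukasiewicz algebras are Kleene algebras. -/
theorem lukasiewicz_inf_neg_le_sup_neg (hinv : ∀ x, neg (neg x) = x)
    (hdm : ∀ x y, neg (x ⊔ y) = neg x ⊓ neg y)
    (hax1 : ∀ x, neg x ⊔ nabla x = ⊤)
    (hax2 : ∀ x, x ⊓ neg x = neg x ⊓ nabla x)
    (hax3 : ∀ x y, nabla (x ⊓ y) = nabla x ⊓ nabla y) (x y : A) :
    x ⊓ neg x ≤ y ⊔ neg y := by
  set g := x ⊓ neg x with hg
  set h := y ⊔ neg y with hh
  have hgg : g ≤ neg g := by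
    rw [hg, deMorgan_neg_inf hinv hdm, hinv]
    exact inf_le_left.trans le_sup_right
  have hhh : neg h ≤ h := by
    rw [hh, hdm, hinv]
    exact inf_le_left.trans le_sup_right
  have hnh : nabla h = ⊤ := by
    rw [← hax1 h, eq_comm, sup_eq_right]
    exact hhh.trans (lukasiewicz_le_nabla hax1 hax2 h)
  have hnab : nabla (h ⊓ g) = nabla g := by rw [hax3, hnh, top_inf_eq]
  calc g = neg g ⊓ nabla g := by rw [← hax2, inf_eq_left.mpr hgg]
    _ ≤ neg (h ⊓ g) ⊓ nabla (h ⊓ g) := by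
      rw [hnab]
      exact inf_le_inf_right _ (deMorgan_neg_antitone hdm inf_le_right)
    _ = (h ⊓ g) ⊓ neg (h ⊓ g) := (hax2 _).symm
    _ ≤ h := inf_le_left.trans inf_le_left

end Lukasiewicz

/-- Claim (2) in the proof of Theorem 3.2: `M s(x) = s(∇x)`. -/
theorem lukasiewicz_claim2 {A : Type*} [DistribLattice A] [BoundedOrder A]
    (neg nabla : A → A)
    (hinv : ∀ x : A, neg (neg x) = x)
    (hdm : ∀ x y : A, neg (x ⊔ y) = neg x ⊓ neg y)
    (hax1 : ∀ x : A, neg x ⊔ nabla x = ⊤)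
    (hax2 : ∀ x : A, x ⊓ neg x = neg x ⊓ nabla x)
    (hax3 : ∀ x y : A, nabla (x ⊓ y) = nabla x ⊓ nabla y)
    (R : {P : Set A // IsPrimeFilter P} → {P : Set A // IsPrimeFilter P} → Prop)
    (hR : ∀ P Q, R P Q ↔ (P.1 ⊆ Q.1 ∨ Q.1 ⊆ P.1))
    (M : Set {P : Set A // IsPrimeFilter P} → Set {P : Set A // IsPrimeFilter P})
    (hM : ∀ X, M X = {P | ∃ Q ∈ X, R P Q})
    (s : A → Set {P : Set A // IsPrimeFilter P})
    (hs : ∀ x : A, s x = {P | x ∈ P.1}) :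
    ∀ x : A, M (s x) = s (nabla x) := by
  intro x
  rw [hM, hs, hs]
  ext ⟨P, hP⟩
  simp only [Set.mem_ofPred_eq, hR]
  have hle := lukasiewicz_le_nabla hax1 hax2 x
  constructor
  · rintro ⟨⟨Q, hQ⟩, hxQ, hPQ | hQP⟩
    · exact hP.mem_of_subset_of_isCompl hQ hPQ
        (lukasiewicz_isCompl_nabla hinv hdm hax1 hax2 hax3 x) (hQ.mem_of_le hxQ hle)
    · exact hP.mem_of_le (hQP hxQ) hle
  · intro hnx
    by_cases hx : x ∈ P
    · exact ⟨⟨P, hP⟩, hx, Or.inl subset_rfl⟩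
    · have hnegx : neg x ∉ P := fun h =>
        hx (hP.mem_of_le (hax2 x ▸ hP.inf_mem h hnx) inf_le_left)
      refine ⟨⟨_, hP.setOf_neg_notMem hinv hdm⟩, hnegx, Or.inl fun a ha hna => ?_⟩
      have hKleene := lukasiewicz_inf_neg_le_sup_neg hinv hdm hax1 hax2 hax3 a x
      exact (hP.mem_or_mem (hP.mem_of_le (hP.inf_mem ha hna) hKleene)).elim hx hnegx
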